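/- Let d, λ ≥ 1 be fixed integers with d ≥ λ and α(d,λ) < 1 (the non-trivial range). Then lim_{k→∞} ζ(k,d,λ)/k = 2 − α(d,λ); that is, for every ε > 0 there exists K such that for all integers k ≥ K (with k ≥ λ+1), |ζ(k,d,λ)/k − (2 − α(d,λ))| < ε. -/

import Mathlib

open Finset

noncomputable section

/-- Points of `ℝ^d`. -/
abbrev Pt (d : ℕ) : Type := Fin d → ℝ

/-- `L` is a complete Kneser `(d-λ)`-transversal of the finite point set `X` with respect
to `k`. -/
def IsCompleteKneserTransversal (k d lam : ℕ) (X : Finset (Pt d))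
    (L : AffineSubspace ℝ (Pt d)) : Prop :=
  Module.finrank ℝ L.direction = d - lam ∧
  (∃ T : Finset (Pt d), T ⊆ X ∧ T.card = d - lam + 1 ∧ (T : Set (Pt d)) ⊆ (L : Set (Pt d))) ∧
  ∀ Y : Finset (Pt d), Y ⊆ X → Y.card = k →
    ((convexHull ℝ (Y : Set (Pt d))) ∩ (L : Set (Pt d))).Nonempty

/-- `X` has a complete Kneser `(d-λ)`-transversal with respect to `k`. -/
def HasCKT (k d lam : ℕ) (X : Finset (Pt d)) : Prop :=
  ∃ L : AffineSubspace ℝ (Pt d), IsCompleteKneserTransversal k d lam X L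

/-- The moment curve `γ(t) = (t, t², …, t^d)` in `ℝ^d`. -/
def momentCurve (d : ℕ) (t : ℝ) : Pt d := fun i => t ^ ((i : ℕ) + 1)

/-- The vertex set `{γ(t₁), …, γ(t_n)}` of a cyclic polytope. -/
def cyclicVerts (d n : ℕ) (t : Fin n → ℝ) : Finset (Pt d) :=
  Finset.image (fun i => momentCurve d (t i)) Finset.univ

/-- The set of positive integers `n` such that for every choice of reals
`t₁ < … < t_n` the vertex set of the corresponding cyclic polytope in `ℝ^d` has a
complete Kneser `(d-λ)`-transversal with respect to `k`; `ζ(k,d,λ)` is its maximum. -/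
def zetaSet (k d lam : ℕ) : Set ℕ :=
  {n | 0 < n ∧ ∀ t : Fin n → ℝ, StrictMono t → HasCKT k d lam (cyclicVerts d n t)}

/-- `α(d,λ) = (λ-1)/⌈d/2⌉` (note `⌈d/2⌉ = (d+1)/2` as naturals). -/
def alphaVal (d lam : ℕ) : ℝ := ((lam : ℝ) - 1) / (((d + 1) / 2 : ℕ) : ℝ)


/-- `ζ(k,d,λ)`: the maximum positive integer `n` such that for all reals `t₁ < … < t_n`
the vertex set of the corresponding cyclic polytope has a complete Kneser
`(d-λ)`-transversal with respect to `k`. -/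
def zeta (k d lam : ℕ) : ℕ := sSup (zetaSet k d lam)


section MomentCurve

/-- The linear functional on `ℝ^d` that restricts to `p - p(0)` on the moment curve. -/
def coeffFunctional (d : ℕ) (p : Polynomial ℝ) : Pt d →ₗ[ℝ] ℝ :=
  ∑ i : Fin d, p.coeff ((i : ℕ) + 1) • LinearMap.proj i

lemma coeffFunctional_momentCurve {d : ℕ} {p : Polynomial ℝ} (hp : p.natDegree ≤ d) (t : ℝ) :
    coeffFunctional d p (momentCurve d t) = p.eval t - p.coeff 0 := by
  rw [Polynomial.eval_eq_sum_range' (Nat.lt_succ_of_le hp), Finset.sum_range_succ',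
    ← Fin.sum_univ_eq_sum_range (fun i => p.coeff (i + 1) * t ^ (i + 1))]
  simp [coeffFunctional, momentCurve]

/-- A linear functional on `ℝ^d`, minus a constant, is a polynomial along the moment curve. -/
lemma exists_polynomial_eval_eq (d : ℕ) (f : Pt d →ₗ[ℝ] ℝ) (c : ℝ) :
    ∃ p : Polynomial ℝ, p.natDegree ≤ d ∧ ∀ t, p.eval t = f (momentCurve d t) - c := by
  refine ⟨(∑ i : Fin d, Polynomial.C (f (Pi.single i 1)) * Polynomial.X ^ ((i : ℕ) + 1))
    - Polynomial.C c, ?_, fun t => ?_⟩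
  · refine (Polynomial.natDegree_sub_le _ _).trans (max_le ?_ (by simp))
    refine Polynomial.natDegree_sum_le_of_forall_le _ _ fun i _ => ?_
    exact (Polynomial.natDegree_C_mul_X_pow_le _ _).trans i.2
  · have h := f.pi_apply_eq_sum_univ (momentCurve d t)
    rw [h]
    simp only [Polynomial.eval_sub, Polynomial.eval_finsetSum, Polynomial.eval_mul,
      Polynomial.eval_C, Polynomial.eval_pow, Polynomial.eval_X, smul_eq_mul]
    congr 1
    refine Finset.sum_congr rfl fun i _ => ?_
    rw [mul_comm, momentCurve]
    congr 2
    ext j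
    simp [Pi.single_apply, eq_comm]

lemma momentCurve_injective {d : ℕ} (hd : 1 ≤ d) : Function.Injective (momentCurve d) := by
  intro a b h
  simpa [momentCurve] using congrFun h ⟨0, hd⟩

/-- At most `d + 1` points of the moment curve in `ℝ^d` are affinely independent. -/
lemma affineIndependent_momentCurve {d : ℕ} (T : Finset ℝ) (hT : T.card ≤ d + 1) :
    AffineIndependent ℝ (fun s : T => momentCurve d s) := by
  rw [affineIndependent_iff]
  intro U w hw hwp e he
  set p : Polynomial ℝ := ∏ s ∈ T.erase e, (Polynomial.X - Polynomial.C s) with hp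
  have hdeg : p.natDegree ≤ d := by
    rw [hp, Polynomial.natDegree_prod_of_monic _ _ fun s _ => Polynomial.monic_X_sub_C s]
    simp only [Polynomial.natDegree_X_sub_C, Finset.sum_const, smul_eq_mul, mul_one,
      Finset.card_erase_of_mem e.2]
    omega
  have key : ∑ s ∈ U, w s * p.eval (s : ℝ) = 0 := by
    have h1 := congrArg (coeffFunctional d p) hwp
    simp only [map_sum, map_smul, map_zero, coeffFunctional_momentCurve hdeg, smul_eq_mul,
      mul_sub, Finset.sum_sub_distrib, ← Finset.sum_mul] at h1
    rw [show ∑ s ∈ U, w s = 0 from hw] at h1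
    simpa using h1
  rw [Finset.sum_eq_single_of_mem e he] at key
  · refine (mul_eq_zero.1 key).resolve_right ?_
    rw [hp, Polynomial.eval_prod]
    refine Finset.prod_ne_zero_iff.2 fun s hs => ?_
    simpa [sub_eq_zero] using (Finset.ne_of_mem_erase hs).symm
  · intro s _ hse
    have : p.eval (s : ℝ) = 0 := by
      rw [hp, Polynomial.eval_prod]
      exact Finset.prod_eq_zero (Finset.mem_erase.2 ⟨fun h => hse (Subtype.ext h), s.2⟩) (by simp)
    rw [this, mul_zero]

lemma range_momentCurve_subtype (d : ℕ) (T : Finset ℝ) :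
    Set.range (fun s : T => momentCurve d s) = (T.image (momentCurve d) : Finset (Pt d)) := by
  ext v; simp

/-- A polynomial of degree at most `d` vanishing at the nodes of a transversal is positive at
fewer than `k` of the parameters. -/
lemma exists_nodes_of_hasCKT {k d lam : ℕ} (hlam : 1 ≤ lam) (hdl : lam ≤ d) {V : Finset ℝ}
    (h : HasCKT k d lam (V.image (momentCurve d))) :
    ∃ T ⊆ V, T.card = d - lam + 1 ∧ ∀ p : Polynomial ℝ, p.natDegree ≤ d →
      (∀ s ∈ T, p.eval s = 0) → {x ∈ V | 0 < p.eval x}.card < k := by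
  obtain ⟨L, hfin, ⟨T', hT'X, hT'card, hT'L⟩, hconv⟩ := h
  have hinj := momentCurve_injective (hlam.trans hdl)
  obtain ⟨T, hTV, rfl⟩ := Finset.subset_image_iff.1 hT'X
  rw [Finset.card_image_of_injective _ hinj] at hT'card
  refine ⟨T, hTV, hT'card, fun p hp hpT => ?_⟩
  by_contra! hk
  obtain ⟨Y, hYsub, hYcard⟩ := Finset.exists_subset_card_eq hk
  obtain ⟨v, hvY, hvL⟩ := hconv (Y.image (momentCurve d))
    (Finset.image_subset_image (hYsub.trans (Finset.filter_subset _ _)))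
    (by rw [Finset.card_image_of_injective _ hinj, hYcard])
  have hind := affineIndependent_momentCurve (d := d) T (by omega)
  have hspan : affineSpan ℝ (Set.range fun s : T => momentCurve d s) = L := by
    apply hind.affineSpan_eq_of_le_of_card_eq_finrank_add_one
    · rw [range_momentCurve_subtype]
      exact affineSpan_le.2 hT'L
    · rw [Fintype.card_coe, hfin, hT'card]
  have hvL' : coeffFunctional d p v = - p.coeff 0 := by
    have hle : affineSpan ℝ (Set.range fun s : T => momentCurve d s) ≤
        (affineSpan ℝ {- p.coeff 0}).comap (coeffFunctional d p).toAffineMap := by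
      rw [affineSpan_le]
      rintro _ ⟨s, rfl⟩
      simp [coeffFunctional_momentCurve hp, hpT s s.2]
    have := hle (hspan ▸ hvL : v ∈ affineSpan ℝ (Set.range fun s : T => momentCurve d s))
    simpa using this
  have hvY' : - p.coeff 0 < coeffFunctional d p v := by
    have hsub : convexHull ℝ ((Y.image (momentCurve d) : Finset (Pt d)) : Set (Pt d)) ⊆
        {v | - p.coeff 0 < coeffFunctional d p v} := by
      refine convexHull_min ?_ (convex_halfSpace_gt (coeffFunctional d p).isLinear _)
      intro x hx
      obtain ⟨y, hy, rfl⟩ := Finset.mem_image.1 (Finset.mem_coe.1 hx)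
      have := (Finset.mem_filter.1 (hYsub hy)).2
      simp only [Set.mem_ofPred_eq, coeffFunctional_momentCurve hp]
      linarith
    exact hsub hvY
  exact absurd hvL' hvY'.ne'

/-- If every polynomial of degree at most `d` vanishing on `T` is positive at fewer than `k` of
the parameters, then the points of parameters in `T` span a transversal. -/
lemma hasCKT_of_nodes {k d lam : ℕ} (hlam : 1 ≤ lam) (hdl : lam ≤ d) {V T : Finset ℝ}
    (hTV : T ⊆ V) (hT : T.card = d - lam + 1)
    (h : ∀ p : Polynomial ℝ, p.natDegree ≤ d →
      (∀ s ∈ T, p.eval s = 0) → {x ∈ V | 0 < p.eval x}.card < k) :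
    HasCKT k d lam (V.image (momentCurve d)) := by
  have hinj := momentCurve_injective (hlam.trans hdl)
  have hind := affineIndependent_momentCurve (d := d) T (by omega)
  set L := affineSpan ℝ (Set.range fun s : T => momentCurve d s) with hL
  have hTL : ∀ s ∈ T, momentCurve d s ∈ L := fun s hs =>
    subset_affineSpan ℝ _ ⟨⟨s, hs⟩, rfl⟩
  refine ⟨L, ?_, ⟨T.image (momentCurve d), Finset.image_subset_image hTV, ?_, ?_⟩, ?_⟩
  · rw [hL, direction_affineSpan]
    exact hind.finrank_vectorSpan (by rw [Fintype.card_coe, hT])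
  · rw [Finset.card_image_of_injective _ hinj, hT]
  · rw [← range_momentCurve_subtype]
    exact subset_affineSpan ℝ _
  · intro Y' hY' hYcard
    obtain ⟨Y, hYV, rfl⟩ := Finset.subset_image_iff.1 hY'
    rw [Finset.card_image_of_injective _ hinj] at hYcard
    rw [← Set.not_disjoint_iff_nonempty_inter]
    intro hdisj
    obtain ⟨f, u, v, hfu, huv, hvf⟩ := geometric_hahn_banach_compact_closed (convex_convexHull ℝ _)
      (Set.Finite.isCompact_convexHull ℝ (Finset.finite_toSet (Y.image (momentCurve d))))
      L.convex L.closed_of_finiteDimensional hdisj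
    obtain ⟨s₀, hs₀⟩ : T.Nonempty := Finset.card_pos.1 (by omega)
    have hconst : ∀ x ∈ L, f x = f (momentCurve d s₀) := by
      intro x hx
      by_contra hne
      have hne' : f x - f (momentCurve d s₀) ≠ 0 := sub_ne_zero.2 hne
      have hmem := AffineMap.lineMap_mem
        ((v - 1 - f (momentCurve d s₀)) / (f x - f (momentCurve d s₀))) (hTL s₀ hs₀) hx
      have := hvf _ hmem
      rw [AffineMap.lineMap_apply] at this
      simp only [vsub_eq_sub, vadd_eq_add, map_add, map_smul, map_sub, smul_eq_mul,
        div_mul_cancel₀ _ hne'] at this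
      linarith
    obtain ⟨p, hp, hpe⟩ := exists_polynomial_eval_eq d (-f : Pt d →L[ℝ] ℝ).toLinearMap
      (-f (momentCurve d s₀))
    have hlt := h p hp fun s hs => by
      rw [hpe]; simp [hconst _ (hTL s hs)]
    refine absurd (Finset.card_le_card (s := Y) (fun y hy => ?_))
      (not_le.2 (hlt.trans_eq hYcard.symm))
    refine Finset.mem_filter.2 ⟨hYV hy, ?_⟩
    have h1 := hfu (momentCurve d y)
      (subset_convexHull ℝ _ (Finset.mem_coe.2 (Finset.mem_image_of_mem _ hy)))
    have h2 := hvf _ (hTL s₀ hs₀)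
    rw [hpe]
    simp
    linarith

end MomentCurve

section SignPatterns

/-- Any sign pattern on the intervals cut out by a finite set `T` is attained off `T` by a
polynomial vanishing on `T` that has one extra root per node at which the sign persists. -/
lemma exists_polynomial_sign (pos : ℕ → Prop) [DecidablePred pos] (T : Finset ℝ) :
    ∃ p : Polynomial ℝ,
      p.natDegree ≤ T.card + {j ∈ Finset.range T.card | (pos j ↔ pos (j + 1))}.card ∧
      (∀ s ∈ T, p.eval s = 0) ∧
      ∀ x ∉ T, p.eval x ≠ 0 ∧ (0 < p.eval x ↔ pos {y ∈ T | y < x}.card) := by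
  induction T using Finset.induction_on_max with
  | empty =>
    by_cases h : pos 0
    · exact ⟨1, by simp, by simp, by simp [h]⟩
    · exact ⟨-1, by simp, by simp, fun x _ => by simp [h]⟩
  | insert a T ha ih =>
    obtain ⟨p, hdeg, hroot, hsign⟩ := ih
    have haT : a ∉ T := fun h => lt_irrefl _ (ha a h)
    have hrank_lt : ∀ x < a, {y ∈ insert a T | y < x} = {y ∈ T | y < x} := fun x hx => by
      rw [Finset.filter_insert, if_neg (not_lt.2 hx.le)]
    have hrank_gt : ∀ x, a < x → {y ∈ insert a T | y < x}.card = T.card + 1 := fun x hx => by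
      rw [Finset.filter_true_of_mem, Finset.card_insert_of_notMem haT]
      intro y hy
      rcases Finset.mem_insert.1 hy with rfl | hy
      exacts [hx, (ha y hy).trans hx]
    have hrank_gt' : ∀ x, a < x → {y ∈ T | y < x}.card = T.card := fun x hx => by
      rw [Finset.filter_true_of_mem fun y hy => (ha y hy).trans hx]
    rw [Finset.card_insert_of_notMem haT, Finset.range_add_one, Finset.filter_insert]
    by_cases hflip : (pos T.card ↔ pos (T.card + 1))
    · rw [if_pos hflip, Finset.card_insert_of_notMem (by simp)]
      refine ⟨p * (Polynomial.X - Polynomial.C a) ^ 2, ?_, ?_, ?_⟩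
      · refine Polynomial.natDegree_mul_le.trans ?_
        have := Polynomial.natDegree_pow_le (p := (Polynomial.X - Polynomial.C a)) (n := 2)
        rw [Polynomial.natDegree_X_sub_C] at this
        omega
      · intro s hs
        rcases Finset.mem_insert.1 hs with rfl | hs
        · simp
        · simp [hroot s hs]
      · intro x hx
        rw [Finset.mem_insert, not_or] at hx
        have hsq : 0 < (x - a) ^ 2 := sq_pos_of_ne_zero (sub_ne_zero.2 hx.1)
        obtain ⟨h1, h2⟩ := hsign x hx.2
        simp only [Polynomial.eval_mul, Polynomial.eval_pow, Polynomial.eval_sub,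
          Polynomial.eval_X, Polynomial.eval_C]
        refine ⟨mul_ne_zero h1 hsq.ne', ?_⟩
        rw [mul_pos_iff_of_pos_right hsq, h2]
        rcases lt_or_gt_of_ne hx.1 with hxa | hxa
        · rw [hrank_lt x hxa]
        · rw [hrank_gt x hxa, hrank_gt' x hxa, hflip]
    · rw [if_neg hflip]
      refine ⟨p * (Polynomial.C a - Polynomial.X), ?_, ?_, ?_⟩
      · refine Polynomial.natDegree_mul_le.trans ?_
        have : (Polynomial.C a - Polynomial.X : Polynomial ℝ).natDegree ≤ 1 :=
          (Polynomial.natDegree_sub_le _ _).trans (by simp)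
        omega
      · intro s hs
        rcases Finset.mem_insert.1 hs with rfl | hs
        · simp
        · simp [hroot s hs]
      · intro x hx
        rw [Finset.mem_insert, not_or] at hx
        obtain ⟨h1, h2⟩ := hsign x hx.2
        simp only [Polynomial.eval_mul, Polynomial.eval_sub, Polynomial.eval_X, Polynomial.eval_C]
        refine ⟨mul_ne_zero h1 (sub_ne_zero.2 (Ne.symm hx.1)), ?_⟩
        rcases lt_or_gt_of_ne hx.1 with hxa | hxa
        · rw [hrank_lt x hxa, ← h2, mul_pos_iff_of_pos_right (sub_pos.2 hxa)]
        · rw [hrank_gt' x hxa] at h2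
          rw [hrank_gt x hxa, mul_pos_iff]
          have h3 : a - x < 0 := sub_neg.2 hxa
          have h4 : p.eval x < 0 ↔ ¬ 0 < p.eval x := by
            rw [not_lt]; exact ⟨le_of_lt, fun h => lt_of_le_of_ne h h1⟩
          rw [h4, h2]
          have h5 : ¬ 0 < a - x := h3.not_gt
          tauto

/-- The `M`-periodic predicate failing at the `A` residues `0, 2, …, 2A - 2`. -/
def cyclicPattern (M A c : ℕ) : Prop := ¬ (Even (c % M) ∧ c % M < 2 * A)

instance (M A : ℕ) : DecidablePred (cyclicPattern M A) := fun _ =>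
  inferInstanceAs (Decidable (¬ _))

lemma cyclicPattern_periodic (M A : ℕ) : Function.Periodic (cyclicPattern M A) M := fun c => by
  simp [cyclicPattern]

lemma card_cyclicPattern {M A : ℕ} (h : 2 * A ≤ M) (c : ℕ) :
    {x ∈ Finset.Ico c (c + M) | cyclicPattern M A x}.card = M - A := by
  rw [Nat.filter_Ico_card_eq_of_periodic _ _ _ (cyclicPattern_periodic M A),
    Nat.count_eq_card_filter_range]
  have himg : {x ∈ Finset.range M | ¬ cyclicPattern M A x} = (Finset.range A).image (2 * ·) := by
    ext x
    simp only [cyclicPattern, not_not, Finset.mem_filter, Finset.mem_range, Finset.mem_image]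
    constructor
    · rintro ⟨h1, ⟨y, hy⟩, h2⟩
      rw [Nat.mod_eq_of_lt h1] at hy h2
      exact ⟨y, by omega, by omega⟩
    · rintro ⟨y, hy, rfl⟩
      have h1 : 2 * y < M := by omega
      rw [Nat.mod_eq_of_lt h1]
      exact ⟨h1, even_two_mul y, by omega⟩
  have hsum := Finset.card_filter_add_card_filter_not (s := Finset.range M) (cyclicPattern M A)
  rw [himg, Finset.card_image_of_injective _ (fun _ _ h => by simpa using h),
    Finset.card_range, Finset.card_range] at hsum
  exact Nat.eq_sub_of_add_eq hsum

lemma card_cyclicPattern_iff_succ_le {M A m : ℕ} (hA : 1 ≤ A) (h : 2 * A ≤ M) (hm : m ≤ M)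
    (c : ℕ) :
    {j ∈ Finset.range m | (cyclicPattern M A (c + j) ↔ cyclicPattern M A (c + (j + 1)))}.card
      ≤ M - 2 * A := by
  set P : ℕ → Prop := fun x => (cyclicPattern M A x ↔ cyclicPattern M A (x + 1)) with hP
  have hper : Function.Periodic P M := fun x => by
    simp only [hP]
    rw [cyclicPattern_periodic, show x + M + 1 = x + 1 + M by ring, cyclicPattern_periodic]
  calc _ ≤ {x ∈ Finset.Ico c (c + M) | P x}.card := by
        refine Finset.card_le_card_of_injOn (c + ·) ?_ (add_right_injective c).injOn
        intro j hj
        simp only [Finset.coe_filter, Finset.mem_range, Set.mem_ofPred_eq] at hj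
        simp only [Finset.coe_filter, Finset.mem_Ico, Set.mem_ofPred_eq]
        exact ⟨by omega, hj.2⟩
    _ = {x ∈ Finset.range M | P x}.card := by
        rw [Nat.filter_Ico_card_eq_of_periodic _ _ _ hper, Nat.count_eq_card_filter_range]
    _ ≤ (Finset.Ico (2 * A - 1) (M - 1)).card := by
        refine Finset.card_le_card fun x hx => ?_
        obtain ⟨hx, hPx⟩ := Finset.mem_filter.1 hx
        rw [Finset.mem_range] at hx
        rw [Finset.mem_Ico]
        simp only [hP, cyclicPattern, Nat.even_iff] at hPx
        rcases Nat.lt_or_ge (x + 1) M with h1 | h1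
        · rw [Nat.mod_eq_of_lt h1, Nat.mod_eq_of_lt hx] at hPx
          omega
        · obtain rfl : M = x + 1 := by omega
          rw [Nat.mod_self, Nat.mod_eq_of_lt hx] at hPx
          omega
    _ = M - 2 * A := by rw [Nat.card_Ico]; omega

/-- Averaging over the rotations of the cyclic pattern gives a polynomial that vanishes on `T` and
is positive on a large proportion of the remaining points. -/
lemma exists_polynomial_many_pos {M A m : ℕ} (hA : 1 ≤ A) (h : 2 * A ≤ M) (hm : m ≤ M)
    {V T : Finset ℝ} (hTV : T ⊆ V) (hT : T.card = m) :
    ∃ p : Polynomial ℝ, p.natDegree ≤ m + (M - 2 * A) ∧ (∀ s ∈ T, p.eval s = 0) ∧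
      (M - A) * (V.card - m) ≤ M * {x ∈ V | 0 < p.eval x}.card := by
  set rank : ℝ → ℕ := fun x => {y ∈ T | y < x}.card with hrank
  obtain ⟨c, -, hc⟩ : ∃ c ∈ Finset.range M, (M - A) * (V.card - m) ≤
      M * {x ∈ V \ T | cyclicPattern M A (c + rank x)}.card := by
    refine Finset.exists_le_of_sum_le (Finset.nonempty_range_iff.2 (by omega)) ?_
    rw [← Finset.mul_sum, ← Finset.mul_sum]
    have hdouble := Finset.sum_card_bipartiteAbove_eq_sum_card_bipartiteBelow
      (fun (c : ℕ) (x : ℝ) => cyclicPattern M A (c + rank x)) (s := Finset.range M) (t := V \ T)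
    simp only [Finset.bipartiteAbove, Finset.bipartiteBelow] at hdouble
    have hcount : ∀ x ∈ V \ T,
        {c ∈ Finset.range M | cyclicPattern M A (c + rank x)}.card = M - A := by
      intro x _
      rw [← card_cyclicPattern h (rank x)]
      refine Finset.card_bij (fun c _ => c + rank x) ?_ (fun _ _ _ _ h => by simpa using h) ?_
      · intro c hc
        simp only [Finset.mem_filter, Finset.mem_range, Finset.mem_Ico] at hc ⊢
        exact ⟨by omega, hc.2⟩
      · intro y hy
        simp only [Finset.mem_filter, Finset.mem_Ico] at hy
        refine ⟨y - rank x, ?_, by omega⟩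
        simp only [Finset.mem_filter, Finset.mem_range]
        exact ⟨by omega, by rw [Nat.sub_add_cancel hy.1.1]; exact hy.2⟩
    rw [hdouble, Finset.sum_congr rfl hcount]
    simp only [Finset.sum_const, Finset.card_range, smul_eq_mul]
    rw [Finset.card_sdiff_of_subset hTV, hT, mul_comm (M - A), mul_assoc]
  obtain ⟨p, hdeg, hroot, hsign⟩ := exists_polynomial_sign (fun j => cyclicPattern M A (c + j)) T
  rw [hT] at hdeg
  refine ⟨p, hdeg.trans (Nat.add_le_add_left (card_cyclicPattern_iff_succ_le hA h hm c) _), hroot,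
    hc.trans (Nat.mul_le_mul_left _ (Finset.card_le_card fun x hx => ?_))⟩
  simp only [Finset.mem_filter, Finset.mem_sdiff] at hx ⊢
  exact ⟨hx.1.1, (hsign x hx.1.2).2.2 hx.2⟩

end SignPatterns

section Alternation

/-- Along a sequence interlaced with `m` of its roots, a polynomial of degree at most `m + r` is
positive at both ends of at most `r` of the first `m` intervals. -/
lemma card_consecutive_pos_le {m r : ℕ} {x s : ℕ → ℝ} (hxs : ∀ i, x i < s i)
    (hsx : ∀ i, s i < x (i + 1)) {p : Polynomial ℝ} (hp : p.natDegree ≤ m + r)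
    (hroot : ∀ i < m, p.eval (s i) = 0) :
    {i ∈ Finset.range m | 0 < p.eval (x i) ∧ 0 < p.eval (x (i + 1))}.card ≤ r := by
  rcases eq_or_ne p 0 with rfl | hp0
  · simp
  have hx : StrictMono x := strictMono_nat_of_lt_succ fun i => (hxs i).trans (hsx i)
  have hs : StrictMono s := strictMono_nat_of_lt_succ fun i => (hsx i).trans (hxs (i + 1))
  set w : Polynomial ℝ := ∏ i ∈ Finset.range m, (Polynomial.X - Polynomial.C (s i)) with hw
  have hwdeg : w.natDegree = m := by
    rw [hw, Polynomial.natDegree_prod_of_monic _ _ fun i _ => Polynomial.monic_X_sub_C (s i)]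
    simp
  obtain ⟨q, rfl⟩ : w ∣ p := Finset.prod_dvd_of_coprime
    (fun i _ j _ hij => Polynomial.pairwise_coprime_X_sub_C hs.injective hij)
    fun i hi => Polynomial.dvd_iff_isRoot.2 (hroot i (Finset.mem_range.1 hi))
  have hq0 : q ≠ 0 := right_ne_zero_of_mul hp0
  rw [Polynomial.natDegree_mul (left_ne_zero_of_mul hp0) hq0, hwdeg] at hp
  have hwsign : ∀ i < m, w.eval (x i) * w.eval (x (i + 1)) < 0 := by
    intro i hi
    simp only [hw, Polynomial.eval_prod, Polynomial.eval_sub, Polynomial.eval_X, Polynomial.eval_C,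
      ← Finset.prod_mul_distrib]
    rw [← Finset.mul_prod_erase _ _ (Finset.mem_range.2 hi)]
    refine mul_neg_of_neg_of_pos
      (mul_neg_of_neg_of_pos (sub_neg.2 (hxs i)) (sub_pos.2 (hsx i)))
      (Finset.prod_pos fun j hj => ?_)
    rcases lt_or_gt_of_ne (Finset.ne_of_mem_erase hj) with hji | hji
    · have h1 : s j < x i := (hsx j).trans_le (hx.monotone hji)
      exact mul_pos (sub_pos.2 h1) (sub_pos.2 (h1.trans (hx i.lt_succ_self)))
    · have h1 : x (i + 1) < s j := (hx.monotone hji).trans_lt (hxs j)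
      exact mul_pos_of_neg_of_neg (sub_neg.2 ((hx i.lt_succ_self).trans h1)) (sub_neg.2 h1)
  have hex : ∀ i, i ∈ {i ∈ Finset.range m | 0 < (w * q).eval (x i) ∧ 0 < (w * q).eval (x (i + 1))} →
      ∃ y ∈ Set.Ioo (x i) (x (i + 1)), q.eval y = 0 := by
    intro i hi
    simp only [Finset.mem_filter, Finset.mem_range, Polynomial.eval_mul] at hi
    obtain ⟨him, h1, h2⟩ := hi
    have hqneg : q.eval (x i) * q.eval (x (i + 1)) < 0 := by
      have := mul_pos h1 h2
      rw [mul_mul_mul_comm] at this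
      exact (neg_iff_neg_of_mul_pos this).1 (hwsign i him)
    rcases mul_neg_iff.1 hqneg with ⟨ha, hb⟩ | ⟨ha, hb⟩
    · exact intermediate_value_Ioo' (hx i.lt_succ_self).le q.continuous.continuousOn ⟨hb, ha⟩
    · exact intermediate_value_Ioo (hx i.lt_succ_self).le q.continuous.continuousOn ⟨ha, hb⟩
  choose! y hy hqy using hex
  calc _ ≤ q.roots.toFinset.card := by
        refine Finset.card_le_card_of_injOn y (fun i hi => ?_) (fun i hi j hj hij => ?_)
        · simpa [hq0] using hqy i hi
        · have hi' := hy i hi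
          have hj' := hy j hj
          rw [hij] at hi'
          have h1 := hx.lt_iff_lt.1 (hi'.1.trans hj'.2)
          have h2 := hx.lt_iff_lt.1 (hj'.1.trans hi'.2)
          omega
    _ ≤ q.natDegree := (Multiset.toFinset_card_le _).trans q.card_roots'
    _ ≤ r := by omega

/-- The sign alternations forced by the nodes bound the number of positive values. -/
lemma card_pos_le_of_interlaced {M m r N : ℕ} (hM : M ≤ m + 1) (hN : M + r = 2 * N)
    {x s : ℕ → ℝ} (hxs : ∀ i, x i < s i)
    (hsx : ∀ i, s i < x (i + 1)) {p : Polynomial ℝ} (hp : p.natDegree ≤ m + r)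
    (hroot : ∀ i < m, p.eval (s i) = 0) :
    {i ∈ Finset.range M | 0 < p.eval (x i)}.card ≤ N := by
  set P := {i ∈ Finset.range M | 0 < p.eval (x i)} with hP
  set Q := P.image (· + 1) with hQ
  have hQcard : Q.card = P.card := Finset.card_image_of_injective _ (add_left_injective 1)
  have hunion : (P ∪ Q).card ≤ M + 1 := by
    rw [← Finset.card_range (M + 1)]
    refine Finset.card_le_card fun i hi => ?_
    simp only [hP, hQ, Finset.mem_union, Finset.mem_image, Finset.mem_filter,
      Finset.mem_range] at hi ⊢
    rcases hi with hi | ⟨j, hj, rfl⟩ <;> omega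
  have hinter : (P ∩ Q).card ≤ r := by
    refine le_trans (Finset.card_le_card fun i hi => ?_)
      ((Finset.card_image_le (f := (· + 1))).trans (card_consecutive_pos_le hxs hsx hp hroot))
    simp only [hP, hQ, Finset.mem_inter, Finset.mem_image, Finset.mem_filter,
      Finset.mem_range] at hi ⊢
    obtain ⟨hi, j, hj, rfl⟩ := hi
    exact ⟨j, ⟨by omega, hj.2, hi.2⟩, rfl⟩
  have := Finset.card_union_add_card_inter P Q
  omega

/-- A finite strictly increasing sequence extends to an infinite one. -/
lemma exists_strictMono_extension {n : ℕ} (hn : 0 < n) {t : Fin n → ℝ} (ht : StrictMono t) :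
    ∃ u : ℕ → ℝ, StrictMono u ∧ ∀ i : Fin n, u i = t i := by
  refine ⟨fun i => t ⟨min i (n - 1), by omega⟩ + ((i - (n - 1) : ℕ) : ℝ), ?_, fun i => ?_⟩
  · refine strictMono_nat_of_lt_succ fun i => ?_
    rcases Nat.lt_or_ge i (n - 1) with hi | hi
    · refine add_lt_add_of_lt_of_le (ht (Fin.mk_lt_mk.2 (by omega))) ?_
      exact_mod_cast (by omega : i - (n - 1) ≤ i + 1 - (n - 1))
    · refine add_lt_add_of_le_of_lt (ht.monotone (Fin.mk_le_mk.2 (by omega))) ?_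
      exact_mod_cast (by omega : i - (n - 1) < i + 1 - (n - 1))
  · have h1 : min (i : ℕ) (n - 1) = i := by omega
    have h2 : (i : ℕ) - (n - 1) = 0 := by omega
    simp [h1, h2]

/-- Choosing every `(b + 1)`-st parameter as a node keeps the number of positive values of an
admissible polynomial at most `N * b`. -/
lemma card_pos_le_of_periodic_nodes {M m r N b n : ℕ} (hM : M = m ∨ M = m + 1)
    (hn : n = m + M * b) (hN : M + r = 2 * N) {u : ℕ → ℝ} (hu : StrictMono u)
    {p : Polynomial ℝ} (hp : p.natDegree ≤ m + r)
    (hroot : ∀ l < m, p.eval (u (l * (b + 1) + b)) = 0) :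
    {i ∈ Finset.range n | 0 < p.eval (u i)}.card ≤ N * b := by
  have key : ∀ j ∈ Finset.range b,
      {i ∈ {i ∈ Finset.range n | 0 < p.eval (u i)} | i % (b + 1) = j}.card ≤ N := by
    intro j hj
    rw [Finset.mem_range] at hj
    refine le_trans ?_ (card_pos_le_of_interlaced (M := M) (by omega) hN
      (x := fun l => u (l * (b + 1) + j)) (s := fun l => u (l * (b + 1) + b))
      (fun l => hu (by omega)) (fun l => hu (by rw [add_mul]; omega)) hp hroot)
    refine Finset.card_le_card_of_injOn (· / (b + 1)) (fun i hi => ?_) (fun i hi i' hi' h => ?_)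
    · simp only [Finset.coe_filter, Finset.mem_filter, Finset.mem_range, Set.mem_ofPred_eq] at hi ⊢
      obtain ⟨⟨hin, hpos⟩, hij⟩ := hi
      have hdiv := Nat.div_add_mod' i (b + 1)
      rw [hij] at hdiv
      rw [hdiv]
      refine ⟨Nat.div_lt_of_lt_mul ?_, hpos⟩
      rw [mul_comm, mul_add]
      omega
    · simp only [Finset.coe_filter, Finset.mem_filter, Set.mem_ofPred_eq] at hi hi'
      rw [← Nat.div_add_mod' i (b + 1), ← Nat.div_add_mod' i' (b + 1), hi.2, hi'.2]
      simp only at h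
      rw [h]
  have := Finset.card_le_mul_card_image_of_maps_to (f := (· % (b + 1))) (t := Finset.range b)
    (s := {i ∈ Finset.range n | 0 < p.eval (u i)}) ?_ N key
  · simpa using this
  · intro i hi
    obtain ⟨hin, hpos⟩ := Finset.mem_filter.1 hi
    rw [Finset.mem_range] at hin ⊢
    have hlt := Nat.mod_lt i (Nat.succ_pos b)
    refine lt_of_le_of_ne (Nat.lt_succ_iff.1 hlt) fun h => ?_
    have hdiv := Nat.div_add_mod' i (b + 1)
    rw [h] at hdiv
    rw [← hdiv, hroot] at hpos
    · exact lt_irrefl _ hpos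
    · by_contra! hge
      have := Nat.mul_le_mul_right (b + 1) hge
      rw [mul_add, mul_one] at this
      rcases hM with rfl | rfl
      · omega
      · rw [add_mul] at hn
        omega

end Alternation

section Bounds

lemma cyclicVerts_eq_image (d n : ℕ) (t : Fin n → ℝ) :
    cyclicVerts d n t = (Finset.univ.image t).image (momentCurve d) := by
  rw [Finset.image_image]; rfl

lemma mem_zetaSet_of_mul_lt {k d lam b : ℕ} (hlam : 1 ≤ lam) (hdl : lam ≤ d)
    (hb : (d + 1) / 2 * b < k) :
    d - lam + 1 + (2 * ((d + 1) / 2) - (lam - 1)) * b ∈ zetaSet k d lam := by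
  set N := (d + 1) / 2 with hN
  set M := 2 * N - (lam - 1) with hM
  set m := d - lam + 1 with hm
  set n := m + M * b with hn
  have hMm : M = m ∨ M = m + 1 := by omega
  have hn0 : 0 < n := by omega
  refine ⟨hn0, fun t ht => ?_⟩
  obtain ⟨u, hu, hut⟩ := exists_strictMono_extension hn0 ht
  have hV : Finset.univ.image t = (Finset.range n).image u := by
    ext x
    simp only [Finset.mem_image, Finset.mem_univ, true_and, Finset.mem_range]
    exact ⟨fun ⟨i, hi⟩ => ⟨i, i.2, (hut i).trans hi⟩,
      fun ⟨i, hi, hx⟩ => ⟨⟨i, hi⟩, (hut ⟨i, hi⟩).symm.trans hx⟩⟩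
  rw [cyclicVerts_eq_image, hV]
  have hnode : StrictMono fun l => u (l * (b + 1) + b) := strictMono_nat_of_lt_succ fun l =>
    hu (by rw [add_mul]; omega)
  refine hasCKT_of_nodes hlam hdl (T := (Finset.range m).image fun l => u (l * (b + 1) + b)) ?_
    (by rw [Finset.card_image_of_injective _ hnode.injective, Finset.card_range]) ?_
  · intro x hx
    obtain ⟨l, hl, rfl⟩ := Finset.mem_image.1 hx
    refine Finset.mem_image_of_mem _ (Finset.mem_range.2 ?_)
    have h1 := Nat.mul_le_mul_right (b + 1) (Nat.succ_le_of_lt (Finset.mem_range.1 hl))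
    have h2 : m * b ≤ M * b := Nat.mul_le_mul_right b (by omega)
    rw [Nat.succ_mul, mul_add m, mul_one] at h1
    omega
  · intro p hp hroot
    refine lt_of_le_of_lt ?_ hb
    rw [Finset.filter_image, Finset.card_image_of_injective _ hu.injective]
    exact card_pos_le_of_periodic_nodes (M := M) (m := m) (r := lam - 1) hMm hn (by omega) hu
      (hp.trans (by omega))
      fun l hl => hroot _ (Finset.mem_image_of_mem _ (Finset.mem_range.2 hl))

lemma mul_le_of_mem_zetaSet {k d lam n : ℕ} (hlam : 1 ≤ lam) (hdl : lam ≤ d)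
    (hα : lam - 1 < (d + 1) / 2) (hn : n ∈ zetaSet k d lam) :
    (d + 1) / 2 * (n - (d - lam + 1)) ≤ (2 * ((d + 1) / 2) - (lam - 1)) * k := by
  set N := (d + 1) / 2 with hN
  set M := 2 * N - (lam - 1) with hM
  set t : Fin n → ℝ := fun i => ((i : ℕ) : ℝ) with ht
  have htm : StrictMono t := fun i j hij => by simpa [ht] using hij
  have h := hn.2 t htm
  rw [cyclicVerts_eq_image] at h
  obtain ⟨T, hTV, hT, hpos⟩ := exists_nodes_of_hasCKT hlam hdl h
  obtain ⟨p, hp, hroot, hle⟩ := exists_polynomial_many_pos (M := M) (A := N - (lam - 1))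
    (m := d - lam + 1) (by omega) (by omega) (by omega) hTV hT
  have hlt := hpos p (hp.trans (by omega)) hroot
  rw [Finset.card_image_of_injective _ htm.injective, Finset.card_univ, Fintype.card_fin,
    show M - (N - (lam - 1)) = N by omega] at hle
  exact hle.trans (Nat.mul_le_mul_left _ hlt.le)

end Bounds

/-- in the non-trivial range `α(d,λ) < 1`, for fixed `d` and `λ`,
`lim_{k→∞} ζ(k,d,λ)/k = 2 - α(d,λ)`. -/
theorem zeta_asymptotics (d lam : ℕ) (hd : 1 ≤ d) (hlam : 1 ≤ lam) (hdl : lam ≤ d)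
    (hα : alphaVal d lam < 1) :
    ∀ ε : ℝ, 0 < ε → ∃ K : ℕ, ∀ k : ℕ, K ≤ k → lam + 1 ≤ k →
      |((zeta k d lam : ℝ) / (k : ℝ)) - (2 - alphaVal d lam)| < ε := by
  set N := (d + 1) / 2 with hN
  set M := 2 * N - (lam - 1) with hM
  set m := d - lam + 1 with hm
  have hN0 : 0 < N := by omega
  have hNR : (0 : ℝ) < N := by exact_mod_cast hN0
  have hlamN : lam - 1 < N := by
    rw [alphaVal, ← hN, div_lt_one hNR] at hα
    have : (lam : ℝ) < N + 1 := by linarith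
    have : lam < N + 1 := by exact_mod_cast this
    omega
  have hMR : (M : ℝ) = (2 - alphaVal d lam) * N := by
    have h1 : M + lam = 2 * N + 1 := by omega
    have h2 : (M : ℝ) + lam = 2 * N + 1 := by exact_mod_cast h1
    rw [alphaVal, ← hN, sub_mul, div_mul_cancel₀ _ hNR.ne']
    linarith
  intro ε hε
  obtain ⟨K, hK⟩ := exists_nat_gt (((m : ℝ) + M) / ε)
  refine ⟨K, fun k hKk hk => ?_⟩
  have hkR : (0 : ℝ) < k := by exact_mod_cast (by omega : 0 < k)
  have hupper : ∀ n ∈ zetaSet k d lam, N * n ≤ N * m + M * k := fun n hn => by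
    have h1 : N * (n - m) ≤ M * k := mul_le_of_mem_zetaSet hlam hdl hlamN hn
    have h2 := Nat.mul_le_mul_left N (show n ≤ m + (n - m) by omega)
    rw [mul_add] at h2
    omega
  have hbdd : BddAbove (zetaSet k d lam) := ⟨N * m + M * k, fun n hn =>
    (Nat.le_mul_of_pos_left n hN0).trans (hupper n hn)⟩
  set b := (k - 1) / N with hb
  have hbk : N * b < k := by
    have : N * b ≤ k - 1 := Nat.mul_div_le (k - 1) N
    omega
  have hmem := mem_zetaSet_of_mul_lt hlam hdl hbk
  have hlower : m + M * b ≤ zeta k d lam := le_csSup hbdd hmem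
  have hzeta := hupper _ (Nat.sSup_mem ⟨_, hmem⟩ hbdd)
  change N * zeta k d lam ≤ _ at hzeta
  have hbk' : k ≤ N * b + N := by
    have h1 := Nat.div_add_mod (k - 1) N
    have h2 := Nat.mod_lt (k - 1) hN0
    rw [← hb] at h1
    omega
  have hzetaR : (N : ℝ) * zeta k d lam ≤ N * m + M * k := by exact_mod_cast hzeta
  have hlowerR : (m : ℝ) + M * b ≤ zeta k d lam := by exact_mod_cast hlower
  have hbkR : (k : ℝ) ≤ N * b + N := by exact_mod_cast hbk'
  have hm0 : (0 : ℝ) ≤ m := m.cast_nonneg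
  have hM0 : (0 : ℝ) ≤ M := M.cast_nonneg
  have hα0 : 0 ≤ 2 - alphaVal d lam := by linarith
  have hup : (zeta k d lam : ℝ) ≤ m + (2 - alphaVal d lam) * k := by
    rw [hMR] at hzetaR
    refine le_of_mul_le_mul_left ?_ hNR
    linarith
  have hlow : (2 - alphaVal d lam) * k - M ≤ zeta k d lam := by
    have := mul_le_mul_of_nonneg_left hbkR hα0
    rw [mul_add, ← mul_assoc, ← hMR] at this
    linarith
  have hsmall : (m : ℝ) + M < ε * k := by
    rw [div_lt_iff₀ hε] at hK
    have : (K : ℝ) ≤ k := by exact_mod_cast hKk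
    nlinarith
  rw [div_sub' hkR.ne', abs_div, abs_of_pos hkR, div_lt_iff₀ hkR, abs_lt]
  constructor <;> linarith
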